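/- For every real λ with 0 < λ ≤ 1, setting c = (1 − λ)/18, one has (1 − e^{−c}) / (2·(1 + (3/4)·(1−λ)/λ)) ≥ c·λ/2 + 2·c²·λ. In other words, the soundness rejection probability q'_Reject exceeds the completeness rejection probability p'_Reject = cλ/2 + c²λ by at least c²λ. (The concluding gap inequality of Claim 4.3.) -/

import Mathlib

/-- The second-order Taylor polynomial of `exp (-x)` is an upper bound for `0 ≤ x`. -/
theorem exp_neg_le_quadratic {x : ℝ} (hx : 0 ≤ x) :
    Real.exp (-x) ≤ 1 - x + x ^ 2 / 2 := by
  have hquad := Real.quadratic_le_exp_of_nonneg hx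
  rw [Real.exp_neg, inv_le_iff_one_le_mul₀ (Real.exp_pos x)]
  have hpos : 0 ≤ 1 - x + x ^ 2 / 2 := by nlinarith [sq_nonneg (x - 1)]
  nlinarith [mul_le_mul_of_nonneg_left hquad hpos, sq_nonneg (x ^ 2)]

/-- Concluding gap inequality of Claim 4.3: with `c = (1−λ)/18`,
`(1 − e^{−c})/(2(1 + (3/4)(1−λ)/λ)) ≥ cλ/2 + 2c²λ` for `0 < λ ≤ 1`. -/
theorem test2_rejection_gap (lam : ℝ) (hl0 : 0 < lam) (hl1 : lam ≤ 1)
    (c : ℝ) (hc : c = (1 - lam) / 18) :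
    (1 - Real.exp (-c)) / (2 * (1 + (3 / 4) * (1 - lam) / lam))
      ≥ c * lam / 2 + 2 * c ^ 2 * lam := by
  have hc0 : 0 ≤ c := by linarith
  obtain rfl : lam = 1 - 18 * c := by linarith
  have hden : 0 < 1 - 9 / 2 * c := by linarith
  have hlhs : (1 - Real.exp (-c)) / (2 * (1 + (3 / 4) * (1 - (1 - 18 * c)) / (1 - 18 * c)))
      = (1 - 18 * c) * (1 - Real.exp (-c)) / (2 * (1 - 9 / 2 * c)) := by
    have hsum : 1 + (3 / 4) * (1 - (1 - 18 * c)) / (1 - 18 * c)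
        = (1 - 9 / 2 * c) / (1 - 18 * c) := by
      rw [eq_div_iff hl0.ne', add_mul, div_mul_cancel₀ _ hl0.ne']
      ring
    rw [hsum, ← mul_div_assoc, div_div_eq_mul_div, mul_comm (1 - Real.exp (-c))]
  rw [hlhs, ge_iff_le, le_div_iff₀ (by positivity)]
  have hkey : (c + 4 * c ^ 2) * (1 - 9 / 2 * c) ≤ 1 - Real.exp (-c) := by
    nlinarith [exp_neg_le_quadratic hc0, pow_nonneg hc0 3]
  linarith [mul_le_mul_of_nonneg_left hkey hl0.le]
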